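/- arXiv:1206.1973 — 2 statements merged into one kernel-verified Lean document; each statement's English description precedes it below -/
import Mathlib

section
/- Let ℓ ≤ m, let Σw be an ℓ×ℓ Hermitian positive definite complex matrix with spectral decomposition Σw = Uw Λw Uw†, where Uw is unitary and Λw = Diag(λw_1,…,λw_ℓ) with eigenvalues in ascending order 0 < λw_1 ≤ … ≤ λw_ℓ, and let Σx be an m×m Hermitian positive semidefinite complex matrix with spectral decomposition Σx = Ux Λx Ux†, where Ux is unitary and Λx = Diag(λx_1,…,λx_m) with eigenvalues in descending order λx_1 ≥ … ≥ λx_m ≥ 0. Suppose η > 0 is such that the numbers λ*_i (i = 1,…,ℓ) defined by λ*_i = max(0, 1/η − λw_i/λx_i) when λx_i > 0 and λ*_i = 0 when λx_i = 0 satisfy Σ_{i=1}^ℓ λ*_i = ℓ. Define M* = Uw [Diag(√λ*_1,…,√λ*_ℓ) | 0_{ℓ×(m−ℓ)}] Ux†. Then tr(M* M*†) = ℓ, and for every complex ℓ×m matrix M with tr(M M†) ≤ ℓ one has det(I_m + M† Σw⁻¹ M Σx) ≤ det(I_m + M*† Σw⁻¹ M* Σx) (both determinants being positive real numbers). In other words,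 M* maximizes the Gaussian mutual information log det(I_m + M† Σw⁻¹ M Σx) subject to the average unit-norm row (power) constraint (1/ℓ) tr(M M†) ≤ 1. -/
open Matrix
open scoped BigOperators ComplexOrder

/-- The Cauchy–Binet formula, summed over all maps of index sets rather than over subsets. -/
theorem card_perm_mul_det_mul {k n R : Type*} [Fintype k] [DecidableEq k] [Fintype n]
    [CommRing R] (A : Matrix k n R) (B : Matrix n k R) :
    (Fintype.card (Equiv.Perm k) : R) * (A * B).det =
      ∑ f : k → n, (A.submatrix id f).det * (B.submatrix f id).det := by
  classical
  have h1 : (A * B).det = ∑ f : k → n, (A.submatrix id f).det * ∏ i, B (f i) i := by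
    simp only [det_apply', mul_apply, Finset.prod_univ_sum, Finset.mul_sum,
      Fintype.piFinset_univ, Finset.sum_mul]
    rw [Finset.sum_comm]
    simp [Finset.prod_mul_distrib, mul_assoc]
  have h2 (τ : Equiv.Perm k) : (A * B).det = ∑ f : k → n, (A.submatrix id f).det *
      (((Equiv.Perm.sign τ : ℤ) : R) * ∏ i, B (f (τ i)) i) := by
    rw [h1, ← (τ.arrowCongr (Equiv.refl n)).symm.sum_comp]
    refine Finset.sum_congr rfl fun f _ => ?_
    have h := det_permute' τ (A.submatrix id f)
    rw [submatrix_submatrix] at h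
    have e : (τ.arrowCongr (Equiv.refl n)).symm f = f ∘ τ := rfl
    rw [e, ← Function.comp_id id, h]
    simp only [Function.comp_apply, Function.id_comp]
    ring
  calc _ = ∑ τ : Equiv.Perm k, (A * B).det := by simp [Finset.card_univ]
    _ = ∑ τ : Equiv.Perm k, ∑ f : k → n, (A.submatrix id f).det *
      (((Equiv.Perm.sign τ : ℤ) : R) * ∏ i, B (f (τ i)) i) := Finset.sum_congr rfl fun τ _ => h2 τ
    _ = _ := by
      rw [Finset.sum_comm]
      simp_rw [det_apply' (B.submatrix _ _), Finset.mul_sum, submatrix_apply, id]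

theorem det_conjTranspose_mul_diagonal_mul_le {k n : Type*} [Fintype k] [DecidableEq k]
    [Fintype n] [DecidableEq n] (Z : Matrix n k ℂ) (x : n → ℝ) (p : ℝ)
    (hp : ∀ f : k → n, Function.Injective f → ∏ i, x (f i) ≤ p) :
    (Zᴴ * diagonal (fun i => (x i : ℂ)) * Z).det ≤ p * (Zᴴ * Z).det := by
  have hc : (0 : ℂ) < Fintype.card (Equiv.Perm k) := by
    exact_mod_cast Fintype.card_pos
  refine le_of_mul_le_mul_left ?_ hc
  rw [Matrix.mul_assoc, mul_left_comm, card_perm_mul_det_mul, card_perm_mul_det_mul, Finset.mul_sum]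
  refine Finset.sum_le_sum fun f _ => ?_
  have e : (diagonal (fun i => (x i : ℂ)) * Z).submatrix f id =
      diagonal (fun i => (x (f i) : ℂ)) * Z.submatrix f id := by
    ext i j
    simp [diagonal_mul]
  have e' : Zᴴ.submatrix id f = (Z.submatrix f id)ᴴ := rfl
  rw [e, e', det_mul, det_diagonal, det_conjTranspose, mul_left_comm]
  by_cases hf : Function.Injective f
  · refine mul_le_mul_of_nonneg_right ?_ (star_mul_self_nonneg _)
    exact_mod_cast hp f hf
  · have : (Z.submatrix f id).det = 0 := by
      simp only [Function.Injective, not_forall] at hf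
      obtain ⟨i, j, hij, hne⟩ := hf
      exact det_zero_of_row_eq hne (by ext; simp [hij])
    simp [this]

theorem Antitone.prod_comp_injective_le {k n : ℕ} (h : k ≤ n) {x : Fin n → ℝ} (hx : Antitone x)
    (hx0 : ∀ i, 0 ≤ x i) {f : Fin k → Fin n} (hf : Function.Injective f) :
    ∏ i, x (f i) ≤ ∏ i : Fin k, x (Fin.castLE h i) := by
  let s := Finset.univ.image f
  have hs : s.card = k := by simp [s, Finset.card_image_of_injective _ hf]
  have e1 : ∏ i, x (f i) = ∏ j ∈ s, x j := by
    rw [Finset.prod_image hf.injOn]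
  have e2 : ∏ j ∈ s, x j = ∏ i, x (s.orderEmbOfFin hs i) := by
    conv_lhs => rw [← Finset.map_orderEmbOfFin_univ s hs, Finset.prod_map]
    rfl
  rw [e1, e2]
  refine Finset.prod_le_prod (fun _ _ => hx0 _) fun i hi => hx ?_
  clear hi
  rw [Fin.le_def]
  obtain ⟨i, hi⟩ := i
  induction i with
  | zero => exact Nat.zero_le _
  | succ i ih =>
    refine Nat.succ_le_of_lt ((ih (by lia)).trans_lt ?_)
    exact (s.orderEmbOfFin hs).strictMono (Fin.mk_lt_mk.2 i.lt_succ_self)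

theorem det_conjTranspose_mul_conj_diagonal_mul_le {k n : ℕ} (h : k ≤ n)
    (Z : Matrix (Fin n) (Fin k) ℂ) {U : Matrix (Fin n) (Fin n) ℂ}
    (hU : U ∈ unitaryGroup (Fin n) ℂ) {x : Fin n → ℝ} (hx : Antitone x) (hx0 : ∀ i, 0 ≤ x i) :
    (Zᴴ * (U * diagonal (fun i => (x i : ℂ)) * Uᴴ) * Z).det ≤
      (∏ i : Fin k, x (Fin.castLE h i) : ℝ) * (Zᴴ * Z).det := by
  have h1 := det_conjTranspose_mul_diagonal_mul_le (Uᴴ * Z) x _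
    fun f hf => hx.prod_comp_injective_le h hx0 hf
  have hU' : U * Uᴴ = 1 := mem_unitaryGroup_iff.1 hU
  rw [conjTranspose_mul, conjTranspose_conjTranspose, Matrix.mul_assoc Zᴴ U (Uᴴ * Z),
    ← Matrix.mul_assoc U, hU', Matrix.one_mul] at h1
  simpa only [Matrix.mul_assoc] using h1

theorem Matrix.PosSemidef.exists_antitone_diagonalization {n : ℕ} {C : Matrix (Fin n) (Fin n) ℂ}
    (hC : C.PosSemidef) : ∃ U ∈ unitaryGroup (Fin n) ℂ, ∃ s : Fin n → ℝ, Antitone s ∧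
      (∀ i, 0 ≤ s i) ∧ C = U * diagonal (fun i => (s i : ℂ)) * Uᴴ := by
  let e := hC.1.eigenvalues
  let σ : Equiv.Perm (Fin n) := Tuple.sort (fun i => - e i)
  let V : Matrix (Fin n) (Fin n) ℂ := hC.1.eigenvectorUnitary
  have hV : V * Vᴴ = 1 := mem_unitaryGroup_iff.1 hC.1.eigenvectorUnitary.2
  have hs : C = V * diagonal (fun i => (e i : ℂ)) * Vᴴ := hC.1.spectral_theorem
  refine ⟨V.submatrix id σ, ?_, e ∘ σ, ?_, fun i => hC.eigenvalues_nonneg _, ?_⟩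
  · rw [mem_unitaryGroup_iff, star_eq_conjTranspose, conjTranspose_submatrix, submatrix_mul_equiv,
      hV, submatrix_id_id]
  · intro i j hij
    have := Tuple.monotone_sort (fun i => - e i) hij
    simpa [σ] using this
  · have : diagonal (fun i => (((e ∘ σ) i : ℝ) : ℂ)) =
        (diagonal (fun i => (e i : ℂ))).submatrix σ σ := by
      rw [submatrix_diagonal_equiv]; rfl
    rw [this, conjTranspose_submatrix, submatrix_mul_equiv, submatrix_mul_equiv, ← hs,
      submatrix_id_id]

/-- Abel summation: if the initial sums of `d` are nonnegative as long as the decreasing weights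
`w` are positive, then the weighted sum of `d` is at least its plain sum times a lower bound
of `w`. -/
theorem mul_sum_le_sum_mul_of_antitone {n : ℕ} {w d : Fin n → ℝ} (hw : Antitone w)
    (hd : ∀ k (h : k ≤ n), (∀ i : Fin k, 0 < w (Fin.castLE h i)) →
      0 ≤ ∑ i : Fin k, d (Fin.castLE h i))
    {c : ℝ} (hc : 0 ≤ c) (hcw : ∀ i, c ≤ w i) : c * ∑ i, d i ≤ ∑ i, w i * d i := by
  induction n generalizing c with
  | zero => simp
  | succ n ih =>
    have h1 := ih (w := fun i => w i.castSucc) (d := fun i => d i.castSucc)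
      (fun i j hij => hw (Fin.castSucc_le_castSucc_iff.2 hij))
      (fun k h hk => hd k (h.trans n.le_succ) hk) (hc.trans (hcw (Fin.last n)))
      (fun i => hw (Fin.le_last _))
    have h2 : 0 ≤ (w (Fin.last n) - c) * ∑ i, d i := by
      rcases (hcw (Fin.last n)).eq_or_lt with h | h
      · simp [h]
      · exact mul_nonneg (sub_nonneg.2 h.le)
          (hd (n + 1) le_rfl fun i => (hc.trans_lt h).trans_le (hw (Fin.le_last _)))
    rw [Fin.sum_univ_castSucc] at h2 ⊢
    rw [Fin.sum_univ_castSucc (fun i => w i * d i)]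
    linarith

theorem div_one_add_mul_log_sub_log_le {s q : ℝ} (hs : 0 < s) (hq : 0 < q) :
    s / (1 + s) * (Real.log q - Real.log s) ≤ Real.log (1 + q) - Real.log (1 + s) := by
  have h := strictConcaveOn_log_Ioi.concaveOn.2 (Set.mem_Ioi.2 one_pos)
    (Set.mem_Ioi.2 (div_pos hq hs)) (show 0 ≤ 1 / (1 + s) by positivity)
    (show 0 ≤ s / (1 + s) by positivity) (by field_simp)
  rw [← Real.log_div hq.ne' hs.ne', ← Real.log_div (by positivity) (by positivity)]
  have e : (1 / (1 + s)) • (1 : ℝ) + (s / (1 + s)) • (q / s) = (1 + q) / (1 + s) := by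
    simp only [smul_eq_mul]
    field_simp
  rw [e] at h
  simpa using h

/-- Weak log-majorization is preserved by `x ↦ 1 + x`. -/
theorem prod_one_add_le_of_prod_le {n : ℕ} {s q : Fin n → ℝ} (hs : Antitone s)
    (hs0 : ∀ i, 0 ≤ s i) (hq0 : ∀ i, 0 ≤ q i)
    (h : ∀ k (h : k ≤ n), ∏ i : Fin k, s (Fin.castLE h i) ≤ ∏ i : Fin k, q (Fin.castLE h i)) :
    ∏ i, (1 + s i) ≤ ∏ i, (1 + q i) := by
  have hq_pos (k) (hk : k ≤ n) (hpos : ∀ i : Fin k, 0 < s (Fin.castLE hk i)) (i : Fin k) :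
      0 < q (Fin.castLE hk i) := by
    refine (hq0 _).lt_of_ne' ?_
    have := (Finset.prod_pos fun i _ => hpos i).trans_le (h k hk)
    exact Finset.prod_ne_zero_iff.1 this.ne' i (Finset.mem_univ i)
  have hs1 (i) : 0 < 1 + s i := by linarith [hs0 i]
  have hq1 (i) : 0 < 1 + q i := by linarith [hq0 i]
  have hw : Antitone fun i => s i / (1 + s i) := fun i j hij => by
    have := hs hij
    simp only
    rw [div_le_div_iff₀ (hs1 _) (hs1 _)]
    linarith
  have hsum := mul_sum_le_sum_mul_of_antitone (d := fun i => Real.log (q i) - Real.log (s i)) hw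
    (fun k hk hpos => by
      replace hpos (i : Fin k) : 0 < s (Fin.castLE hk i) := by
        have := mul_pos (hpos i) (hs1 (Fin.castLE hk i))
        rwa [div_mul_cancel₀ _ (hs1 _).ne'] at this
      rw [Finset.sum_sub_distrib, ← Real.log_prod fun i _ => (hq_pos k hk hpos i).ne',
        ← Real.log_prod fun i _ => (hpos i).ne', sub_nonneg]
      exact Real.log_le_log (Finset.prod_pos fun i _ => hpos i) (h k hk))
    le_rfl (fun i => div_nonneg (hs0 i) (hs1 i).le)
  have hle (i) : s i / (1 + s i) * (Real.log (q i) - Real.log (s i)) ≤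
      Real.log (1 + q i) - Real.log (1 + s i) := by
    rcases (hs0 i).eq_or_lt with h0 | h0
    · simpa [← h0] using Real.log_nonneg (by linarith [hq0 i] : 1 ≤ 1 + q i)
    · refine div_one_add_mul_log_sub_log_le h0 ?_
      exact hq_pos (i + 1) i.isLt (fun j => h0.trans_le (hs (Nat.le_of_lt_succ j.isLt)))
        (Fin.last i)
  have := hsum.trans (Finset.sum_le_sum fun i _ => hle i)
  rw [zero_mul, Finset.sum_sub_distrib, ← Real.log_prod fun i _ => (hs1 i).ne',
    ← Real.log_prod fun i _ => (hq1 i).ne', sub_nonneg] at this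
  exact (Real.log_le_log_iff (Finset.prod_pos fun i _ => hs1 i)
    (Finset.prod_pos fun i _ => hq1 i)).1 this

/-- Optimality of the waterfilling power allocation `l` among allocations `p` of the same total
power over parallel channels with gains `a`. -/
theorem prod_one_add_le_waterfilling {ι : Type*} [Fintype ι] {a l p : ι → ℝ} {η : ℝ}
    (hη : 0 < η) (ha : ∀ i, 0 ≤ a i)
    (hl : ∀ i, l i = if 0 < a i then max 0 (1 / η - 1 / a i) else 0)
    (hp : ∀ i, 0 ≤ p i) (hsum : ∑ i, p i ≤ ∑ i, l i) :
    ∏ i, (1 + p i * a i) ≤ ∏ i, (1 + l i * a i) := by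
  have hl0 (i) : 0 ≤ l i := by
    rw [hl]; split_ifs
    exacts [le_max_left _ _, le_rfl]
  have hp1 (i) : 0 < 1 + p i * a i := by linarith [mul_nonneg (hp i) (ha i)]
  have hl1 (i) : 0 < 1 + l i * a i := by linarith [mul_nonneg (hl0 i) (ha i)]
  have hle (i) : Real.log (1 + p i * a i) - Real.log (1 + l i * a i) ≤ η * (p i - l i) := by
    rw [← Real.log_div (hp1 i).ne' (hl1 i).ne']
    refine (Real.log_le_sub_one_of_pos (div_pos (hp1 i) (hl1 i))).trans ?_
    rw [div_sub_one (hl1 i).ne', div_le_iff₀ (hl1 i)]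
    rcases (ha i).eq_or_lt with h0 | h0
    · have : l i = 0 := by rw [hl, if_neg (by simp [← h0])]
      simpa [← h0, this] using mul_nonneg hη.le (hp i)
    · have h := hl i
      rw [if_pos h0] at h
      rcases le_total (1 / η - 1 / a i) 0 with h' | h'
      · rw [max_eq_left h'] at h
        have : a i ≤ η := by
          rwa [sub_nonpos, one_div_le_one_div hη h0] at h'
        rw [h]
        nlinarith [hp i]
      · rw [max_eq_right h'] at h
        have : η * (1 + l i * a i) = a i := by
          rw [h]; field_simp; ring
        exact le_of_eq (by linear_combination (l i - p i) * this)
  have := Finset.sum_le_sum fun i (_ : i ∈ Finset.univ) => hle i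
  rw [← Finset.mul_sum, Finset.sum_sub_distrib, Finset.sum_sub_distrib,
    ← Real.log_prod fun i _ => (hp1 i).ne', ← Real.log_prod fun i _ => (hl1 i).ne'] at this
  refine (Real.log_le_log_iff (Finset.prod_pos fun i _ => hp1 i)
    (Finset.prod_pos fun i _ => hl1 i)).1 ?_
  nlinarith

/-- The determinant of `1 + K M S Mᴴ Kᴴ` is bounded by the value for jointly diagonal factors with
eigenvalues in the same order. -/
theorem exists_det_one_add_eq_prod_le {ℓ m : ℕ} (hlm : ℓ ≤ m) {K : Matrix (Fin ℓ) (Fin ℓ) ℂ}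
    {g : Fin ℓ → ℝ} (hg : Antitone g) (hg0 : ∀ i, 0 ≤ g i)
    (hK : K * Kᴴ = diagonal fun i => (g i : ℂ))
    {U : Matrix (Fin m) (Fin m) ℂ} (hU : U ∈ unitaryGroup (Fin m) ℂ)
    {x : Fin m → ℝ} (hx : Antitone x) (hx0 : ∀ i, 0 ≤ x i) {S : Matrix (Fin m) (Fin m) ℂ}
    (hS : S.PosSemidef) (hSU : S = U * diagonal (fun i => (x i : ℂ)) * Uᴴ)
    (M : Matrix (Fin ℓ) (Fin m) ℂ) :
    ∃ s p : Fin ℓ → ℝ, (∀ i, 0 ≤ s i) ∧ (∀ i, 0 ≤ p i) ∧ ∑ i, p i = (M * Mᴴ).trace.re ∧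
      (1 + (K * M) * S * (K * M)ᴴ).det = ((∏ i, (1 + s i) : ℝ) : ℂ) ∧
      ∏ i, (1 + s i) ≤ ∏ i, (1 + p i * (x (Fin.castLE hlm i) * g i)) := by
  obtain ⟨V, hV, s, hs, hs0, hC⟩ :=
    (hS.mul_mul_conjTranspose_same (K * M)).exists_antitone_diagonalization
  obtain ⟨W, hW, p, hp, hp0, hMM⟩ :=
    (posSemidef_self_mul_conjTranspose M).exists_antitone_diagonalization
  have hV1 : V * Vᴴ = 1 := mem_unitaryGroup_iff.1 hV
  have hV2 : Vᴴ * V = 1 := mem_unitaryGroup_iff'.1 hV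
  have hW2 : Wᴴ * W = 1 := mem_unitaryGroup_iff'.1 hW
  refine ⟨s, p, hs0, hp0, ?_, ?_, prod_one_add_le_of_prod_le hs hs0
    (fun i => mul_nonneg (hp0 i) (mul_nonneg (hx0 _) (hg0 i))) fun k hk => ?_⟩
  · rw [hMM, trace_mul_comm, ← Matrix.mul_assoc, hW2, Matrix.one_mul, trace_diagonal,
      Complex.re_sum]
    rfl
  · have : (1 : Matrix (Fin ℓ) (Fin ℓ) ℂ) + V * diagonal (fun i => (s i : ℂ)) * Vᴴ =
        V * diagonal (fun i => ((1 + s i : ℝ) : ℂ)) * Vᴴ := by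
      have : diagonal (fun i => ((1 + s i : ℝ) : ℂ)) = 1 + diagonal (fun i => (s i : ℂ)) := by
        rw [← diagonal_one, diagonal_add]
        simp
      rw [this, Matrix.mul_add, Matrix.add_mul, Matrix.mul_one, hV1]
    rw [hC, this, det_mul_right_comm, hV1, Matrix.one_mul, det_diagonal, Complex.ofReal_prod]
  · let Z : Matrix (Fin ℓ) (Fin k) ℂ := V.submatrix id (Fin.castLE hk)
    have hZ (A : Matrix (Fin ℓ) (Fin ℓ) ℂ) :
        Zᴴ * A * Z = (Vᴴ * A * V).submatrix (Fin.castLE hk) (Fin.castLE hk) := rfl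
    have hZ1 : (Zᴴ * Z).det = 1 := by
      have h := hZ 1
      rw [Matrix.mul_one, Matrix.mul_one, hV2,
        submatrix_one _ (Fin.castLE_injective hk)] at h
      rw [h, det_one]
    have hZs : (Zᴴ * (K * M * S * (K * M)ᴴ) * Z).det =
        ((∏ i : Fin k, s (Fin.castLE hk i) : ℝ) : ℂ) := by
      have h : Vᴴ * (K * M * S * (K * M)ᴴ) * V = diagonal (fun i => (s i : ℂ)) := by
        rw [hC]
        calc _ = (Vᴴ * V) * diagonal (fun i => (s i : ℂ)) * (Vᴴ * V) := by
              simp only [Matrix.mul_assoc]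
          _ = _ := by rw [hV2, Matrix.one_mul, Matrix.mul_one]
      rw [hZ, h, submatrix_diagonal _ _ (Fin.castLE_injective hk), det_diagonal,
        Complex.ofReal_prod]
      rfl
    have h1 := det_conjTranspose_mul_conj_diagonal_mul_le (hk.trans hlm) ((K * M)ᴴ * Z) hU hx hx0
    have h2 := det_conjTranspose_mul_conj_diagonal_mul_le hk (Kᴴ * Z) hW hp hp0
    have h3 := det_conjTranspose_mul_conj_diagonal_mul_le hk Z
      (one_mem (unitaryGroup (Fin ℓ) ℂ)) hg hg0
    rw [Matrix.one_mul, conjTranspose_one, Matrix.mul_one, hZ1, mul_one, ← hK] at h3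
    rw [← hMM] at h2
    rw [← hSU] at h1
    simp only [conjTranspose_mul, conjTranspose_conjTranspose, Matrix.mul_assoc]
      at h1 h2 h3 hZs
    rw [hZs] at h1
    have hxk := Finset.prod_nonneg fun (i : Fin k) (_ : i ∈ Finset.univ) =>
      hx0 (Fin.castLE (hk.trans hlm) i)
    have hpk := Finset.prod_nonneg fun (i : Fin k) (_ : i ∈ Finset.univ) => hp0 (Fin.castLE hk i)
    have h := h1.trans (mul_le_mul_of_nonneg_left
      (h2.trans (mul_le_mul_of_nonneg_left h3 (Complex.zero_le_real.2 hpk)))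
      (Complex.zero_le_real.2 hxk))
    rw [← Complex.ofReal_mul, ← Complex.ofReal_mul, Complex.real_le_real] at h
    refine h.trans (le_of_eq ?_)
    rw [Finset.prod_mul_distrib, Finset.prod_mul_distrib, mul_left_comm]
    rfl

theorem rectDiagonal_mul_diagonal_mul_conjTranspose {ℓ m : ℕ} (hlm : ℓ ≤ m) {l : Fin ℓ → ℝ}
    (hl : ∀ i, 0 ≤ l i) (x : Fin m → ℂ) :
    (of fun (i : Fin ℓ) (j : Fin m) => if (j : ℕ) = (i : ℕ) then (√(l i) : ℂ) else 0) *
        diagonal x *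
        (of fun (i : Fin ℓ) (j : Fin m) => if (j : ℕ) = (i : ℕ) then (√(l i) : ℂ) else 0)ᴴ =
      diagonal fun i => l i * x (Fin.castLE hlm i) := by
  have hsq (i) : (√(l i) : ℂ) * √(l i) = l i := by
    rw [← Complex.ofReal_mul, Real.mul_self_sqrt (hl i)]
  ext i j
  have e (a : Fin m) : (a : ℕ) = i ↔ a = Fin.castLE hlm i := by simp [Fin.ext_iff]
  rw [mul_apply]
  simp only [mul_diagonal, of_apply, conjTranspose_apply, e,
    ite_mul, zero_mul, Finset.sum_ite_eq', Finset.mem_univ, if_true]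
  by_cases hij : i = j
  · subst hij
    simp [← hsq]
    ring
  · simp [hij, Fin.val_inj]

/-- Theorem 1: the optimal measurement kernel for a multivariate Gaussian source.
`M⋆ = Uw [Diag(√λ⋆) | 0] Uxᴴ` maximizes the Gaussian mutual information
`log det (I + Mᴴ Sw⁻¹ M Sx)` under the power constraint `tr(M Mᴴ) ≤ ℓ`. -/
theorem gaussian_optimal_kernel (ℓ m : ℕ) (hlm : ℓ ≤ m)
    (Sw : Matrix (Fin ℓ) (Fin ℓ) ℂ) (Sx : Matrix (Fin m) (Fin m) ℂ)
    (hSw : Sw.PosDef) (hSx : Sx.PosSemidef)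
    (Uw : Matrix (Fin ℓ) (Fin ℓ) ℂ) (hUw : Uw ∈ Matrix.unitaryGroup (Fin ℓ) ℂ)
    (Ux : Matrix (Fin m) (Fin m) ℂ) (hUx : Ux ∈ Matrix.unitaryGroup (Fin m) ℂ)
    (lw : Fin ℓ → ℝ) (lx : Fin m → ℝ)
    (hlw_pos : ∀ i, 0 < lw i) (hlw_mono : Monotone lw)
    (hlx_nonneg : ∀ i, 0 ≤ lx i) (hlx_anti : Antitone lx)
    (hdecw : Sw = Uw * Matrix.diagonal (fun i => (lw i : ℂ)) * Uwᴴ)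
    (hdecx : Sx = Ux * Matrix.diagonal (fun i => (lx i : ℂ)) * Uxᴴ)
    (η : ℝ) (hη : 0 < η)
    (ls : Fin ℓ → ℝ)
    (hls : ∀ i : Fin ℓ, ls i =
      if 0 < lx (Fin.castLE hlm i) then max 0 (1 / η - lw i / lx (Fin.castLE hlm i)) else 0)
    (hsum : ∑ i, ls i = (ℓ : ℝ))
    (Mstar : Matrix (Fin ℓ) (Fin m) ℂ)
    (hMstar : Mstar = Uw * (Matrix.of fun (i : Fin ℓ) (j : Fin m) =>
      if (j : ℕ) = (i : ℕ) then (Real.sqrt (ls i) : ℂ) else 0) * Uxᴴ) :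
    Matrix.trace (Mstar * Mstarᴴ) = (ℓ : ℂ) ∧
    ∀ M : Matrix (Fin ℓ) (Fin m) ℂ,
      (Matrix.trace (M * Mᴴ)).re ≤ (ℓ : ℝ) →
        (Matrix.det (1 + Mᴴ * Sw⁻¹ * M * Sx)).im = 0 ∧
        0 < (Matrix.det (1 + Mᴴ * Sw⁻¹ * M * Sx)).re ∧
        (Matrix.det (1 + Mᴴ * Sw⁻¹ * M * Sx)).re ≤
          (Matrix.det (1 + Mstarᴴ * Sw⁻¹ * Mstar * Sx)).re := by
  have hUw1 : Uw * Uwᴴ = 1 := mem_unitaryGroup_iff.1 hUw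
  have hUw2 : Uwᴴ * Uw = 1 := mem_unitaryGroup_iff'.1 hUw
  have hUx2 : Uxᴴ * Ux = 1 := mem_unitaryGroup_iff'.1 hUx
  have hls0 (i) : 0 ≤ ls i := by
    rw [hls]; split_ifs
    exacts [le_max_left _ _, le_rfl]
  have hD := rectDiagonal_mul_diagonal_mul_conjTranspose hlm hls0
  set D : Matrix (Fin ℓ) (Fin m) ℂ := of fun (i : Fin ℓ) (j : Fin m) =>
    if (j : ℕ) = (i : ℕ) then (√(ls i) : ℂ) else 0
  have htr : Matrix.trace (Mstar * Mstarᴴ) = (ℓ : ℂ) := by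
    have h1 := hD 1
    rw [diagonal_one', Matrix.mul_one] at h1
    have : Mstar * Mstarᴴ = Uw * (D * (Uxᴴ * Ux) * Dᴴ) * Uwᴴ := by
      rw [hMstar]
      simp only [conjTranspose_mul, conjTranspose_conjTranspose, Matrix.mul_assoc]
    rw [this, hUx2, Matrix.mul_one, h1, trace_mul_comm, ← Matrix.mul_assoc, hUw2, Matrix.one_mul,
      trace_diagonal]
    simp only [Pi.one_apply, mul_one]
    exact_mod_cast hsum
  let X : Matrix (Fin ℓ) (Fin ℓ) ℂ := diagonal fun i => ((√(lw i))⁻¹ : ℂ)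
  have hX : Xᴴ = X := by
    simp only [X, diagonal_conjTranspose]
    congr 1
    ext i
    simp
  have hXX : X * X = diagonal fun i => (((lw i)⁻¹ : ℝ) : ℂ) := by
    simp only [X, diagonal_mul_diagonal]
    congr 1
    ext i
    rw [← Complex.ofReal_inv, ← Complex.ofReal_mul, ← mul_inv, Real.mul_self_sqrt (hlw_pos i).le]
  let K := X * Uwᴴ
  have hKK : K * Kᴴ = diagonal fun i => (((lw i)⁻¹ : ℝ) : ℂ) := by
    rw [← hXX]
    calc _ = X * (Uwᴴ * Uw) * X := by
          simp only [K, conjTranspose_mul, conjTranspose_conjTranspose, hX, Matrix.mul_assoc]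
      _ = _ := by rw [hUw2, Matrix.mul_one]
  have hinv : Sw⁻¹ = Kᴴ * K := by
    refine inv_eq_right_inv ?_
    calc _ = Uw * diagonal (fun i => (lw i : ℂ)) * (Uwᴴ * Uw) * (X * X) * Uwᴴ := by
          simp only [hdecw, K, conjTranspose_mul, conjTranspose_conjTranspose, hX,
            Matrix.mul_assoc]
      _ = Uw * (diagonal (fun i => (lw i : ℂ)) * (X * X)) * Uwᴴ := by
          simp only [hUw2, Matrix.mul_one, Matrix.mul_assoc]
      _ = 1 := by
          have : diagonal (fun i => (lw i : ℂ)) * (X * X) = 1 := by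
            rw [hXX, diagonal_mul_diagonal, ← diagonal_one]
            congr 1
            ext i
            rw [← Complex.ofReal_mul, mul_inv_cancel₀ (hlw_pos i).ne', Complex.ofReal_one]
          rw [this, Matrix.mul_one, hUw1]
  have hdet (M : Matrix (Fin ℓ) (Fin m) ℂ) :
      (1 + Mᴴ * Sw⁻¹ * M * Sx).det = (1 + (K * M) * Sx * (K * M)ᴴ).det := by
    rw [Matrix.mul_assoc (K * M), det_one_add_mul_comm (K * M), Matrix.mul_assoc Sx,
      det_one_add_mul_comm Sx, hinv]
    simp only [conjTranspose_mul, Matrix.mul_assoc]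
  have hstar : (1 + Mstarᴴ * Sw⁻¹ * Mstar * Sx).det =
      ((∏ i, (1 + ls i * (lx (Fin.castLE hlm i) * (lw i)⁻¹)) : ℝ) : ℂ) := by
    have : (K * Mstar) * Sx * (K * Mstar)ᴴ = X * (Uwᴴ * Uw) *
        (D * (Uxᴴ * Ux) * diagonal (fun i => (lx i : ℂ)) * (Uxᴴ * Ux) * Dᴴ) *
        (Uwᴴ * Uw) * X := by
      simp only [hMstar, hdecx, K, conjTranspose_mul, conjTranspose_conjTranspose, hX,
        Matrix.mul_assoc]
    rw [hdet, this, hUw2, hUx2]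
    simp only [Matrix.mul_one]
    rw [hD, det_one_add_mul_comm, ← Matrix.mul_assoc, hXX, diagonal_mul_diagonal, ← diagonal_one,
      diagonal_add, det_diagonal, Complex.ofReal_prod]
    refine Finset.prod_congr rfl fun i _ => ?_
    push_cast
    ring
  refine ⟨htr, fun M hM => ?_⟩
  obtain ⟨s, p, hs0, hp0, hpsum, hdets, hle⟩ := exists_det_one_add_eq_prod_le hlm
    (fun i j hij => inv_anti₀ (hlw_pos i) (hlw_mono hij)) (fun i => (inv_pos.2 (hlw_pos i)).le) hKK
    hUx hlx_anti hlx_nonneg hSx hdecx M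
  rw [hstar, hdet, hdets, Complex.ofReal_re, Complex.ofReal_re]
  refine ⟨Complex.ofReal_im _, Finset.prod_pos fun i _ => by linarith [hs0 i], hle.trans ?_⟩
  refine prod_one_add_le_waterfilling hη
    (fun i => mul_nonneg (hlx_nonneg _) (inv_pos.2 (hlw_pos i)).le) (fun i => ?_) hp0
    (by rw [hpsum, hsum]; exact hM)
  simp only [hls, mul_pos_iff_of_pos_right (inv_pos.2 (hlw_pos i)), one_div (_ * _), mul_inv,
    inv_inv, div_eq_inv_mul (lw i)]
end

section
/- Let Σ_A and Σ_B be m×m Hermitian positive semidefinite complex matrices with eigenvalues λ_1 ≥ λ_2 ≥ … ≥ λ_m ≥ 0 and μ_1 ≥ μ_2 ≥ … ≥ μ_m ≥ 0 respectively (each listed in descending order with multiplicity). Then det(I_m + Σ_A Σ_B) ≤ Π_{i=1}^m (1 + λ_i μ_i), where det(I_m + Σ_A Σ_B) is a real number. Moreover, if Σ_A and Σ_B have identical eigenvector matrices, i.e., Σ_A = U Diag(λ_1,…,λ_m) U† and Σ_B = U Diag(μ_1,…,μ_m) U† for a common unitary U with both eigenvalue lists in descending order, then equality holds. -/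
open Matrix
open scoped BigOperators ComplexOrder

theorem isHermitian_diagonal_ofReal {n : Type*} [DecidableEq n] (a : n → ℝ) :
    (diagonal fun i => (a i : ℂ)).IsHermitian :=
  isHermitian_diagonal_of_self_adjoint _ (by ext; simp)

section
variable {n : Type*} [Fintype n] [DecidableEq n]

theorem isCompact_unitaryGroup : IsCompact (unitaryGroup n ℂ : Set (Matrix n n ℂ)) := by
  have hbox : IsCompact (Set.univ.pi fun _ : n => Set.univ.pi fun _ : n =>
      Metric.closedBall (0 : ℂ) 1 : Set (Matrix n n ℂ)) :=
    isCompact_univ_pi fun _ => isCompact_univ_pi fun _ => isCompact_closedBall 0 1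
  refine hbox.of_isClosed_subset ?_ fun U hU i _ j _ => by
    simpa using entry_norm_bound_of_unitary hU i j
  have : (unitaryGroup n ℂ : Set (Matrix n n ℂ)) = {U | U * star U = 1} := by
    ext U
    exact mem_unitaryGroup_iff
  rw [this]
  exact isClosed_eq (by fun_prop) continuous_const

theorem eq_zero_of_forall_unit_dotProduct_mulVec {Q : Matrix n n ℂ}
    (h : ∀ v : n → ℂ, star v ⬝ᵥ v = 1 → star v ⬝ᵥ Q *ᵥ v = 0) : Q = 0 := by
  have hall : ∀ v : n → ℂ, star v ⬝ᵥ Q *ᵥ v = 0 := by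
    intro v
    by_cases hv : v = 0
    · simp [hv]
    set x : EuclideanSpace ℂ n := WithLp.toLp 2 v with hx
    have hx0 : x ≠ 0 := by simpa [hx] using hv
    have hxn : (‖x‖ : ℂ) ≠ 0 := by simpa using hx0
    have hself : star v ⬝ᵥ v = (‖x‖ : ℂ) ^ 2 := by
      rw [dotProduct_comm, ← EuclideanSpace.inner_toLp_toLp]
      exact inner_self_eq_norm_sq_to_K x
    have hs : star ((‖x‖ : ℂ)⁻¹) = (‖x‖ : ℂ)⁻¹ := by simp
    have := h ((‖x‖ : ℂ)⁻¹ • v) (by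
      rw [star_smul, smul_dotProduct, dotProduct_smul, hself, hs]
      simp only [smul_eq_mul]
      field_simp)
    rw [star_smul, smul_dotProduct, mulVec_smul, dotProduct_smul, hs] at this
    simpa [hxn, hx0] using this
  have hQ : toEuclideanLin Q = 0 := by
    rw [← inner_map_self_eq_zero]
    intro x
    rw [← inner_conj_symm, EuclideanSpace.inner_eq_star_dotProduct, dotProduct_comm]
    simpa using hall x.ofLp
  simpa using hQ

theorem one_add_smul_vecMulVec_mem_unitaryGroup {v : n → ℂ} (hv : star v ⬝ᵥ v = 1) {z : ℂ}
    (hz : star z * z = 1) : 1 + (z - 1) • vecMulVec v (star v) ∈ unitaryGroup n ℂ := by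
  have hP : vecMulVec v (star v) * vecMulVec v (star v) = vecMulVec v (star v) := by
    rw [vecMulVec_mul_vecMulVec, hv]; simp
  have hs : star (vecMulVec v (star v)) = vecMulVec v (star v) := by
    rw [star_eq_conjTranspose, conjTranspose_vecMulVec, star_star]
  rw [mem_unitaryGroup_iff', star_add, star_smul, hs, star_one, star_sub, star_one, add_mul,
    mul_add, mul_add, smul_mul_smul_comm, hP]
  simp only [mul_one, one_mul]
  rw [add_assoc, ← add_smul, ← add_smul, show z - 1 + (star z - 1 + (star z - 1) * (z - 1)) = 0
    by linear_combination hz, zero_smul, add_zero]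

theorem det_one_add_smul_vecMulVec {v : n → ℂ} (hv : star v ⬝ᵥ v = 1) (z : ℂ) :
    det (1 + (z - 1) • vecMulVec v (star v)) = z := by
  rw [← smul_vecMulVec, vecMulVec_eq Unit, det_one_add_replicateCol_mul_replicateRow,
    dotProduct_smul, hv]
  simp

theorem det_one_add_mul_im_eq_zero {A X : Matrix n n ℂ} (hA : A.IsHermitian)
    (hX : X.IsHermitian) : (det (1 + A * X)).im = 0 := by
  rw [← Complex.conj_eq_iff_im, starRingEnd_apply, ← det_conjTranspose, conjTranspose_add,
    conjTranspose_one, conjTranspose_mul, hA.eq, hX.eq, det_one_add_mul_comm]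

/-- First-order condition at a maximum over the unitary orbit of `X`, along the curve of unitaries
`1 + (exp (i t) - 1) v v*`. -/
theorem trace_mul_eq_one_of_isMaxOn_det {A X : Matrix n n ℂ} (hA : A.IsHermitian)
    (hX : X.IsHermitian) (hdet : det (1 + A * X) ≠ 0)
    (hmax : ∀ U ∈ unitaryGroup n ℂ, (det (1 + A * (U * X * Uᴴ))).re ≤ (det (1 + A * X)).re)
    {v : n → ℂ} (hv : star v ⬝ᵥ v = 1) :
    trace ((1 + A * X)⁻¹ * (vecMulVec v (star v) + A * vecMulVec v (star v) * X)) = 1 := by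
  set P := vecMulVec v (star v) with hP
  set M := 1 + A * X with hM
  set N := P + A * P * X with hN
  set τ := trace (M⁻¹ * N) with hτ
  let z : ℝ → ℂ := fun t => Complex.exp (t * Complex.I)
  have hzz : ∀ t, star (z t) * z t = 1 := fun t => by
    simp only [z, Complex.star_def, ← Complex.exp_conj, ← Complex.exp_add]
    simp
  let U : ℝ → Matrix n n ℂ := fun t => 1 + (z t - 1) • P
  have hU : ∀ t, U t ∈ unitaryGroup n ℂ := fun t =>
    one_add_smul_vecMulVec_mem_unitaryGroup hv (hzz t)
  let h : ℝ → ℂ := fun t => det (1 + A * (U t * X * (U t)ᴴ))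
  obtain ⟨q, hq⟩ : ∃ q : Polynomial ℂ, ∀ w : ℂ,
      det (M + w • N) = det M * (1 + τ * w + q.eval w * w ^ 2) := by
    refine ⟨(det (1 + (Polynomial.X : Polynomial ℂ) • (M⁻¹ * N).map Polynomial.C)).divX.divX,
      fun w => ?_⟩
    rw [← det_one_add_smul, ← det_mul, mul_add, mul_smul_comm, mul_one, ← mul_assoc,
      mul_nonsing_inv _ hdet.isUnit, one_mul]
  have hh : ∀ t, h t = det M * (star (z t) * (1 + τ * (z t - 1) +
      q.eval (z t - 1) * (z t - 1) ^ 2)) := fun t => by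
    have h1 : h t * z t = det (M + (z t - 1) • N) := by
      conv_lhs => rw [← det_one_add_smul_vecMulVec hv (z t)]
      rw [← hP, ← det_mul]
      congr 1
      have := mem_unitaryGroup_iff'.1 (hU t)
      rw [star_eq_conjTranspose] at this
      change (1 + A * (U t * X * (U t)ᴴ)) * U t = _
      rw [add_mul, one_mul, mul_assoc, mul_assoc (U t * X), this, mul_one]
      simp only [U, hM, hN, add_mul, mul_add, smul_mul_assoc, mul_smul_comm, one_mul, mul_assoc,
        smul_add]
      abel
    rw [hq] at h1
    linear_combination star (z t) * h1 - h t * hzz t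
  have hz : HasDerivAt z Complex.I 0 := by
    have := ((Complex.ofRealCLM.hasDerivAt (x := (0 : ℝ))).mul_const Complex.I).cexp
    simpa [z] using this
  have hz0 : z 0 = 1 := by simp [z]
  have hder : HasDerivAt h (det M * (-Complex.I + τ * Complex.I)) 0 := by
    have hw := hz.sub_const 1
    have hq' : HasDerivAt (fun t => q.eval (z t - 1)) (q.derivative.eval (z 0 - 1) * Complex.I) 0 :=
      (q.hasDerivAt (z 0 - 1)).comp_of_eq (0 : ℝ) hw rfl
    have := ((hz.star).mul (((hw.const_mul τ).const_add 1).add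
      (hq'.mul (hw.pow 2)))).const_mul (det M)
    rw [show h = _ from funext hh]
    refine this.congr_deriv ?_
    simp [hz0]
  have hre : (det M * (-Complex.I + τ * Complex.I)).re = 0 := by
    have h1 : HasDerivAt (fun t => (h t).re) _ 0 :=
      Complex.reCLM.hasFDerivAt.comp_hasDerivAt (0 : ℝ) hder
    refine IsLocalMax.hasDerivAt_eq_zero (Filter.Eventually.of_forall fun t => ?_) h1
    have : h 0 = det M := by rw [hh]; simp [hz0]
    simpa only [this] using hmax _ (hU t)
  have him : (det M * (-Complex.I + τ * Complex.I)).im = 0 := by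
    have h1 : HasDerivAt (fun t => (h t).im) _ 0 :=
      Complex.imCLM.hasFDerivAt.comp_hasDerivAt (0 : ℝ) hder
    have h2 : (fun t => (h t).im) = fun _ => 0 := funext fun t =>
      det_one_add_mul_im_eq_zero hA (isHermitian_mul_mul_conjTranspose _ hX)
    rw [h2] at h1
    exact h1.unique (hasDerivAt_const _ _)
  have h0 : det M * (-Complex.I + τ * Complex.I) = 0 := Complex.ext hre him
  have h3 := (mul_eq_zero.1 h0).resolve_left hdet
  linear_combination -Complex.I * h3 + (τ - 1) * Complex.I_mul_I

/-- A maximiser of `det (1 + A X)` over a unitary orbit commutes with `A`. -/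
theorem commute_of_isMaxOn_det {A X : Matrix n n ℂ} (hA : A.IsHermitian)
    (hX : X.IsHermitian) (hdet : det (1 + A * X) ≠ 0)
    (hmax : ∀ U ∈ unitaryGroup n ℂ, (det (1 + A * (U * X * Uᴴ))).re ≤ (det (1 + A * X)).re) :
    Commute A X := by
  set M := 1 + A * X with hM
  have key : M⁻¹ + X * M⁻¹ * A - 1 = 0 := by
    refine eq_zero_of_forall_unit_dotProduct_mulVec fun v hv => ?_
    have h := trace_mul_eq_one_of_isMaxOn_det hA hX hdet hmax hv
    rw [← hM, mul_add, trace_add, ← mul_assoc, trace_mul_comm _ X, ← mul_assoc, ← mul_assoc,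
      mul_vecMulVec, mul_vecMulVec, trace_vecMulVec, trace_vecMulVec] at h
    rw [sub_mulVec, add_mulVec, dotProduct_sub, dotProduct_add, one_mulVec, hv,
      dotProduct_comm, dotProduct_comm _ ((X * M⁻¹ * A) *ᵥ v), h, sub_self]
  have h1 : A * (1 + X * A) = M * A := by rw [hM]; noncomm_ring
  have h2 : M⁻¹ * M = 1 := nonsing_inv_mul _ hdet.isUnit
  have h3 : M⁻¹ * (1 + X * A) = 1 := by
    have : (M⁻¹ + X * M⁻¹ * A - 1) * (1 + X * A) = 0 := by rw [key, zero_mul]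
    rw [sub_mul, add_mul, mul_assoc _ A, h1, mul_assoc X, ← mul_assoc _ M, h2, one_mul, one_mul,
      sub_eq_zero, add_comm (1 : Matrix n n ℂ)] at this
    rw [add_comm (1 : Matrix n n ℂ)]
    exact add_right_cancel (this.trans (add_comm _ _))
  have h4 : 1 + X * A = M := by
    calc 1 + X * A = M * M⁻¹ * (1 + X * A) := by rw [mul_nonsing_inv M hdet.isUnit, one_mul]
      _ = M := by rw [mul_assoc, h3, mul_one]
  exact (add_left_cancel h4).symm

theorem det_one_add_diagonal_mul_diagonal_re (a b : n → ℝ) :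
    (det (1 + diagonal (fun i => (a i : ℂ)) * diagonal (fun i => (b i : ℂ)))).re =
      ∏ i, (1 + a i * b i) := by
  rw [diagonal_mul_diagonal, ← diagonal_one, diagonal_add, det_diagonal]
  norm_cast

theorem permMatrix_mul_diagonal_mul_conjTranspose (σ : Equiv.Perm n) (d : n → ℂ) :
    σ.permMatrix ℂ * diagonal d * (σ.permMatrix ℂ)ᴴ = diagonal (d ∘ σ) := by
  rw [conjTranspose_permMatrix, Equiv.Perm.permMatrix, Equiv.Perm.permMatrix,
    PEquiv.toMatrix_toPEquiv_mul, PEquiv.mul_toMatrix_toPEquiv]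
  ext i j
  simp [diagonal_apply, Equiv.Perm.inv_def]

theorem permMatrix_mem_unitaryGroup (σ : Equiv.Perm n) :
    σ.permMatrix ℂ ∈ unitaryGroup n ℂ := by
  rw [mem_unitaryGroup_iff, star_eq_conjTranspose, conjTranspose_permMatrix, ← permMatrix_mul]
  simp

/-- A matrix commuting with a diagonal matrix with distinct entries is diagonal. -/
theorem eq_diagonal_of_commute_diagonal {d : n → ℂ} (hd : Function.Injective d)
    {X : Matrix n n ℂ} (h : Commute (diagonal d) X) : X = diagonal fun i => X i i := by
  ext i j
  by_cases hij : i = j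
  · simp [hij]
  · have := congrFun₂ h.eq i j
    rw [diagonal_mul, mul_diagonal] at this
    have h0 : (d i - d j) * X i j = 0 := by linear_combination this
    rw [diagonal_apply_ne _ hij]
    exact (mul_eq_zero.1 h0).resolve_left (sub_ne_zero.2 (hd.ne hij))

open Polynomial in
theorem map_eq_map_of_unitary_conj_diagonal {x mu : n → ℝ} {V : Matrix n n ℂ}
    (hV : V ∈ unitaryGroup n ℂ)
    (h : V * diagonal (fun i => (mu i : ℂ)) * Vᴴ = diagonal fun i => (x i : ℂ)) :
    Finset.univ.val.map x = Finset.univ.val.map mu := by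
  have hroots : ∀ y : n → ℝ, (diagonal fun i => (y i : ℂ)).charpoly.roots =
      Finset.univ.val.map fun i => (y i : ℂ) := fun y => by
    rw [charpoly_diagonal, roots_prod _ _ (by simp [Finset.prod_ne_zero_iff, X_sub_C_ne_zero])]
    simp
  have hc : (diagonal fun i => (x i : ℂ)).charpoly = (diagonal fun i => (mu i : ℂ)).charpoly := by
    have hV' := mem_unitaryGroup_iff'.1 hV
    rw [star_eq_conjTranspose] at hV'
    rw [← h, charpoly_mul_comm, ← mul_assoc, hV', one_mul]
  have := congrArg (Multiset.map Complex.re)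
    ((hroots x).symm.trans ((congrArg _ hc).trans (hroots mu)))
  simpa [Multiset.map_map, Function.comp_def] using this

theorem antitone_of_prod_one_add_mul_swap_le [LinearOrder n] {a x : n → ℝ} (ha : StrictAnti a)
    (ha0 : ∀ i, 0 ≤ a i) (hx0 : ∀ i, 0 ≤ x i)
    (h : ∀ i j, ∏ k, (1 + a k * x (Equiv.swap i j k)) ≤ ∏ k, (1 + a k * x k)) : Antitone x := by
  intro i j hij
  by_contra! hlt
  have hne : i ≠ j := by rintro rfl; exact lt_irrefl _ hlt
  have hsplit : ∀ f : n → ℝ, ∏ k, f k = f i * f j * ∏ k ∈ {i, j}ᶜ, f k := fun f => by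
    rw [← Finset.prod_pair hne, Finset.prod_mul_prod_compl]
  have hs := h i j
  rw [hsplit, hsplit, Equiv.swap_apply_left, Equiv.swap_apply_right,
    Finset.prod_congr (g := fun k => 1 + a k * x k) rfl fun k hk => by
      simp only [Finset.mem_compl, Finset.mem_insert, Finset.mem_singleton, not_or] at hk
      rw [Equiv.swap_apply_of_ne_of_ne hk.1 hk.2]] at hs
  have hpos : 0 < ∏ k ∈ {i, j}ᶜ, (1 + a k * x k) :=
    Finset.prod_pos fun k _ => by have := mul_nonneg (ha0 k) (hx0 k); linarith
  have := le_of_mul_le_mul_right hs hpos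
  nlinarith [mul_pos (sub_pos.2 (ha (lt_of_le_of_ne hij hne))) (sub_pos.2 hlt)]

end

theorem eq_of_antitone_of_map_eq {m : ℕ} {x y : Fin m → ℝ} (hx : Antitone x) (hy : Antitone y)
    (h : Finset.univ.val.map x = Finset.univ.val.map y) : x = y := by
  rw [Fin.univ_val_map, Fin.univ_val_map, Multiset.coe_eq_coe] at h
  exact List.ofFn_injective (h.eq_of_sortedGE hx.sortedGE_ofFn hy.sortedGE_ofFn)

theorem det_one_add_diagonal_mul_conj_le_of_strictAnti {m : ℕ} {la mu : Fin m → ℝ}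
    (hla : StrictAnti la) (hmu : Antitone mu) (hla0 : ∀ i, 0 ≤ la i) (hmu0 : ∀ i, 0 ≤ mu i)
    {V : Matrix (Fin m) (Fin m) ℂ} (hV : V ∈ unitaryGroup (Fin m) ℂ) :
    (det (1 + diagonal (fun i => (la i : ℂ)) * (V * diagonal (fun i => (mu i : ℂ)) * Vᴴ))).re ≤
      ∏ i, (1 + la i * mu i) := by
  set A := diagonal (fun i => (la i : ℂ)) with hA
  set D := diagonal (fun i => (mu i : ℂ)) with hD
  have hcont : Continuous fun W : Matrix (Fin m) (Fin m) ℂ => (det (1 + A * (W * D * Wᴴ))).re := by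
    fun_prop
  obtain ⟨W, hW, hmax⟩ := isCompact_unitaryGroup.exists_isMaxOn ⟨V, hV⟩ hcont.continuousOn
  refine (hmax hV).trans ?_
  change (det (1 + A * (W * D * Wᴴ))).re ≤ _
  set X := W * D * Wᴴ with hX
  have hXherm : X.IsHermitian :=
    isHermitian_mul_mul_conjTranspose _ (isHermitian_diagonal_ofReal mu)
  have hmaxX : ∀ U ∈ unitaryGroup (Fin m) ℂ,
      (det (1 + A * (U * X * Uᴴ))).re ≤ (det (1 + A * X)).re := fun U hU => by
    have := hmax (mul_mem hU hW)
    simpa only [Set.mem_ofPred_eq, conjTranspose_mul, hX, mul_assoc] using this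
  have hdet : det (1 + A * X) ≠ 0 := fun h0 => by
    have h1 := hmax (one_mem (unitaryGroup (Fin m) ℂ))
    simp only [Set.mem_ofPred_eq, one_mul, conjTranspose_one, mul_one, ← hX, h0] at h1
    rw [hA, hD, det_one_add_diagonal_mul_diagonal_re] at h1
    exact h1.not_gt (Finset.prod_pos fun i _ => by
      have := mul_nonneg (hla0 i) (hmu0 i); linarith)
  have hcomm := commute_of_isMaxOn_det (isHermitian_diagonal_ofReal la) hXherm hdet hmaxX
  obtain ⟨x, hdiag⟩ : ∃ x : Fin m → ℝ, X = diagonal fun i => (x i : ℂ) := by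
    refine ⟨fun i => (X i i).re, ?_⟩
    conv_lhs => rw [eq_diagonal_of_commute_diagonal
      (fun i j hij => hla.injective (Complex.ofReal_injective hij)) hcomm]
    congr 1
    ext1 i
    exact (Complex.conj_eq_iff_re.1 (hXherm.apply i i)).symm
  have hmap := map_eq_map_of_unitary_conj_diagonal hW hdiag
  have hx0 : ∀ i, 0 ≤ x i := fun i => by
    have : x i ∈ Finset.univ.val.map mu := hmap ▸ Multiset.mem_map_of_mem x (Finset.mem_univ i)
    obtain ⟨j, -, hj⟩ := Multiset.mem_map.1 this
    exact hj ▸ hmu0 j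
  have hxanti : Antitone x := antitone_of_prod_one_add_mul_swap_le hla hla0 hx0 fun i j => by
    have := hmaxX _ (permMatrix_mem_unitaryGroup (Equiv.swap i j))
    rw [hdiag, permMatrix_mul_diagonal_mul_conjTranspose, hA,
      det_one_add_diagonal_mul_diagonal_re] at this
    exact (det_one_add_diagonal_mul_diagonal_re la (x ∘ Equiv.swap i j)).symm.trans_le this
  rw [hdiag, eq_of_antitone_of_map_eq hxanti hmu hmap, hA, det_one_add_diagonal_mul_diagonal_re]

theorem det_one_add_diagonal_mul_conj_le {m : ℕ} {la mu : Fin m → ℝ}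
    (hla : Antitone la) (hmu : Antitone mu) (hla0 : ∀ i, 0 ≤ la i) (hmu0 : ∀ i, 0 ≤ mu i)
    {V : Matrix (Fin m) (Fin m) ℂ} (hV : V ∈ unitaryGroup (Fin m) ℂ) :
    (det (1 + diagonal (fun i => (la i : ℂ)) * (V * diagonal (fun i => (mu i : ℂ)) * Vᴴ))).re ≤
      ∏ i, (1 + la i * mu i) := by
  let p : ℝ → Fin m → ℝ := fun t i => la i + t * (m - i)
  have hp : ∀ t > 0, (det (1 + diagonal (fun i => (p t i : ℂ)) *
      (V * diagonal (fun i => (mu i : ℂ)) * Vᴴ))).re ≤ ∏ i, (1 + p t i * mu i) := fun t ht =>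
    det_one_add_diagonal_mul_conj_le_of_strictAnti
      (fun i j hij => add_lt_add_of_le_of_lt (hla hij.le)
        (mul_lt_mul_of_pos_left (sub_lt_sub_left (by exact_mod_cast hij) _) ht)) hmu
      (fun i => add_nonneg (hla0 i) (mul_nonneg ht.le
        (sub_nonneg.2 (by exact_mod_cast i.2.le)))) hmu0 hV
  have h1 : Continuous fun t => (det (1 + diagonal (fun i => (p t i : ℂ)) *
      (V * diagonal (fun i => (mu i : ℂ)) * Vᴴ))).re := by
    fun_prop
  have h2 : Continuous fun t => ∏ i, (1 + p t i * mu i) := by fun_prop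
  have := le_of_tendsto_of_tendsto (h1.tendsto 0 |>.mono_left nhdsWithin_le_nhds)
    (h2.tendsto 0 |>.mono_left nhdsWithin_le_nhds)
    (Filter.eventually_of_mem (self_mem_nhdsWithin (s := Set.Ioi (0 : ℝ))) hp)
  simpa [p] using this

/-- Witsenhausen's determinant inequality: for Hermitian positive semidefinite `A`, `B`
with eigenvalues `la`, `mu` listed in descending order (with multiplicity),
`det(I + A B) ≤ ∏ (1 + la_i mu_i)` (the determinant being real), with equality when
`A` and `B` have identical eigenvector matrices. -/
theorem witsenhausen_det_inequality (m : ℕ) (A B : Matrix (Fin m) (Fin m) ℂ)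
    (hA : A.PosSemidef) (hB : B.PosSemidef)
    (la mu : Fin m → ℝ) (hla : Antitone la) (hmu : Antitone mu)
    (hla0 : ∀ i, 0 ≤ la i) (hmu0 : ∀ i, 0 ≤ mu i)
    (UA UB : Matrix (Fin m) (Fin m) ℂ)
    (hUA : UA ∈ Matrix.unitaryGroup (Fin m) ℂ)
    (hUB : UB ∈ Matrix.unitaryGroup (Fin m) ℂ)
    (hdecA : A = UA * Matrix.diagonal (fun i => (la i : ℂ)) * UAᴴ)
    (hdecB : B = UB * Matrix.diagonal (fun i => (mu i : ℂ)) * UBᴴ) :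
    (Matrix.det (1 + A * B)).im = 0 ∧
    (Matrix.det (1 + A * B)).re ≤ ∏ i, (1 + la i * mu i) ∧
    (UA = UB → (Matrix.det (1 + A * B)).re = ∏ i, (1 + la i * mu i)) := by
  have hmem : UAᴴ * UB ∈ unitaryGroup (Fin m) ℂ := mul_mem (Unitary.star_mem hUA) hUB
  have hUA' : UAᴴ * UA = 1 := mem_unitaryGroup_iff'.1 hUA
  have hdet : det (1 + A * B) = det (1 + diagonal (fun i => (la i : ℂ)) *
      (UAᴴ * UB * diagonal (fun i => (mu i : ℂ)) * (UAᴴ * UB)ᴴ)) := by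
    rw [hdecA, hdecB, mul_assoc, mul_assoc, det_one_add_mul_comm, conjTranspose_mul,
      conjTranspose_conjTranspose]
    simp only [mul_assoc]
  refine ⟨det_one_add_mul_im_eq_zero hA.isHermitian hB.isHermitian, ?_, fun hU => ?_⟩
  · rw [hdet]
    exact det_one_add_diagonal_mul_conj_le hla hmu hla0 hmu0 hmem
  · rw [hdet, ← hU, hUA', one_mul, conjTranspose_one, mul_one,
      det_one_add_diagonal_mul_diagonal_re]
end
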